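/- Let ε > 0 and let k ≥ 4 be an integer. Let C be an orientation of the k-cycle that contains the oriented path v_1 → v_2 → v_3 ← v_4 ← v_5 as a subdigraph if k ≥ 5, or, if k = 4, let C be the orientation of the 4-cycle on vertices v_1, v_2, v_3, v_4 with arcs v_1v_2, v_2v_3, v_4v_3, v_1v_4 (obtained by identifying the endpoints of v_1 → v_2 → v_3 ← v_4 ← v_5). Then every digraph D without loops or parallel arcs with |V(D)| ≥ 48/ε³, χ(D) ≥ 16·c*_{k−1}/ε² and minimum out-degree at least ε·|V(D)| contains a subdigraph isomorphic to C. -/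

import Mathlib

/-- A digraph `D` (given by its arc relation `E`) contains the digraph given by the
arc relation `F` as a subdigraph: there is an injective map of the vertices preserving arcs. -/
def ContainsDigraph {V W : Type*} (E : V → V → Prop) (F : W → W → Prop) : Prop :=
  ∃ f : W → V, Function.Injective f ∧ ∀ u v : W, F u v → E (f u) (f v)

/-- The orientation of the `k`-cycle determined by `o : ZMod k → Bool`:
the edge `i` of the cycle joins `i` and `i + 1`, and is oriented `i → i + 1`
when `o i = true`, and `i + 1 → i` when `o i = false`. -/
def cycleOrient {k : ℕ} (o : ZMod k → Bool) : ZMod k → ZMod k → Prop :=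
  fun u v => (o u = true ∧ v = u + 1) ∨ (o v = false ∧ u = v + 1)

/-- The arc obtained by orienting the edge `i` of the `k`-cycle according to `o`.
Injectivity of `cycleArc o` says that distinct edges yield distinct arcs, i.e. the
orientation is a genuine digraph without parallel arcs (this is automatic for `k ≥ 3`). -/
def cycleArc {k : ℕ} (o : ZMod k → Bool) (i : ZMod k) : ZMod k × ZMod k :=
  if o i then (i, i + 1) else (i + 1, i)

open Classical in
/-- The number of blocks of the orientation of the `k`-cycle given by `o`:
a directed cycle has a single block, and otherwise the blocks (maximal directed
subpaths) correspond bijectively to the indices `i` at which the orientation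
changes between the consecutive edges `i` and `i + 1`. -/
noncomputable def blockCount {k : ℕ} (o : ZMod k → Bool) : ℕ :=
  if ∀ i, o i = o 0 then 1 else {i : ZMod k | o i ≠ o (i + 1)}.ncard

/-- The orientation of the `k`-cycle given by `o` has a block of length one, i.e.
some edge `i + 1` is a maximal directed subpath on its own. -/
def hasShortBlock {k : ℕ} (o : ZMod k → Bool) : Prop :=
  ∃ i : ZMod k, o i ≠ o (i + 1) ∧ o (i + 1) ≠ o (i + 2)

/-- `T` is an orientation of a tree: a loopless relation, with at most one arc between
any two vertices, whose underlying undirected graph is a tree. -/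
def IsTreeOrientation {W : Type*} (T : W → W → Prop) : Prop :=
  (∀ v, ¬ T v v) ∧ (∀ u v, T u v → ¬ T v u) ∧ (SimpleGraph.fromRel T).IsTree

/-- The chromatic number of (the underlying undirected graph of) the digraph given
by the arc relation `E`. -/
noncomputable def dchrom {V : Type*} (E : V → V → Prop) : ℕ :=
  (SimpleGraph.fromRel E).chromaticNumber.toNat

/-- Burr's constant `c*_j`: the least positive integer `c` such that every digraph
(without loops or parallel arcs) with chromatic number at least `c` contains every
orientation of a tree on `j` vertices as a subdigraph. -/
noncomputable def cstar (j : ℕ) : ℕ :=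
  sInf {c : ℕ | 0 < c ∧
    ∀ (n : ℕ) (E : Fin n → Fin n → Prop), (∀ v, ¬ E v v) →
      (c : ℕ∞) ≤ (SimpleGraph.fromRel E).chromaticNumber →
      ∀ T : Fin j → Fin j → Prop, IsTreeOrientation T → ContainsDigraph E T}

/-- The oriented path `v₁ → v₂ → v₃ ← v₄ ← v₅` on five vertices. -/
def pathFFBB : Fin 5 → Fin 5 → Prop := fun u v =>
  (u = 0 ∧ v = 1) ∨ (u = 1 ∧ v = 2) ∨ (u = 3 ∧ v = 2) ∨ (u = 4 ∧ v = 3)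


/-- `S` can be properly coloured with `m` colours. -/
def ColOn {V : Type*} (E : V → V → Prop) (S : Set V) (m : ℕ) : Prop :=
  ∃ f : V → ℕ, (∀ v ∈ S, f v < m) ∧ ∀ u ∈ S, ∀ v ∈ S, E u v → f u ≠ f v

lemma ColOn.mono {V : Type*} {E : V → V → Prop} {S S' : Set V} {m m' : ℕ}
    (h : ColOn E S m) (hS : S' ⊆ S) (hm : m ≤ m') : ColOn E S' m' := by
  obtain ⟨f, h1, h2⟩ := h
  exact ⟨f, fun v hv => (h1 v (hS hv)).trans_le hm,
    fun u hu v hv => h2 u (hS hu) v (hS hv)⟩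

lemma ColOn.union {V : Type*} {E : V → V → Prop} {A B : Set V} {a b : ℕ}
    (hA : ColOn E A a) (hB : ColOn E B b) : ColOn E (A ∪ B) (a + b) := by
  classical
  obtain ⟨f, f1, f2⟩ := hA
  obtain ⟨g, g1, g2⟩ := hB
  refine ⟨fun v => if v ∈ A then f v else a + g v, ?_, ?_⟩
  · intro v hv
    by_cases h : v ∈ A
    · simp only [h, if_true]; have := f1 v h; omega
    · have hb : v ∈ B := by simpa [h] using hv
      simp only [h, if_false]; have := g1 v hb; omega
  · intro u hu v hv huv
    by_cases h : u ∈ A <;> by_cases h' : v ∈ A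
    · simp only [h, h', if_true]; exact f2 u h v h' huv
    · simp only [h, h', if_true, if_false]; have := f1 u h; omega
    · simp only [h, h', if_true, if_false]; have := f1 v h'; omega
    · have hb : u ∈ B := by simpa [h] using hu
      have hb' : v ∈ B := by simpa [h'] using hv
      simp only [h, h', if_false]; have := g2 u hb v hb' huv; omega

lemma ColOn.biUnion {V ι : Type*} {E : V → V → Prop} (s : Finset ι) (A : ι → Set V) {a : ℕ}
    (hA : ∀ i ∈ s, ColOn E (A i) a) : ColOn E (⋃ i ∈ s, A i) (s.card * a) := by
  classical
  induction s using Finset.induction_on with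
  | empty => exact ⟨fun _ => 0, by simp, by simp⟩
  | insert i s hi ih =>
    have h1 := hA i (Finset.mem_insert_self _ _)
    have h2 := ih (fun j hj => hA j (Finset.mem_insert_of_mem hj))
    rw [Finset.card_insert_of_notMem hi]
    refine (h1.union h2).mono ?_ (by ring_nf; omega)
    simp

lemma ColOn.singleton {V : Type*} {E : V → V → Prop} (hl : ∀ v, ¬ E v v) (w : V) :
    ColOn E {w} 1 := by
  refine ⟨fun _ => 0, by simp, ?_⟩
  rintro u rfl v rfl h
  exact absurd h (hl _)

lemma colorable_of_colOn {V : Type*} {E : V → V → Prop} {m : ℕ}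
    (h : ColOn E Set.univ m) : (SimpleGraph.fromRel E).Colorable m := by
  obtain ⟨f, h1, h2⟩ := h
  refine ⟨SimpleGraph.Coloring.mk (fun v => (⟨f v, h1 v trivial⟩ : Fin m)) ?_⟩
  intro u v huv
  rw [SimpleGraph.fromRel_adj] at huv
  intro he
  have he' : f u = f v := congrArg Fin.val he
  rcases huv.2 with h | h
  · exact h2 u trivial v trivial h he'
  · exact h2 v trivial u trivial h he'.symm

/-- bounded out-degree inside every subset gives few colours -/
lemma colOn_of_outdeg {V : Type*} [DecidableEq V] {E : V → V → Prop} [DecidableRel E]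
    (hl : ∀ v, ¬ E v v) (d : ℕ) (A : Finset V)
    (hd : ∀ v ∈ A, (A.filter (fun u => E v u)).card ≤ d) : ColOn E (A : Set V) (2 * d + 1) := by
  induction hn : A.card generalizing A with
  | zero =>
    have : A = ∅ := Finset.card_eq_zero.mp hn
    subst this
    exact ⟨fun _ => 0, by simp, by simp⟩
  | succ n ih =>
    have hne : A.Nonempty := by rw [← Finset.card_pos]; omega
    have hsum : ∑ v ∈ A, (A.filter (fun u => E u v)).card ≤ ∑ v ∈ A, d := by
      calc ∑ v ∈ A, (A.filter (fun u => E u v)).card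
          = ∑ v ∈ A, (A.filter (fun u => E v u)).card :=
            (Finset.sum_card_bipartiteAbove_eq_sum_card_bipartiteBelow (s := A) (t := A) E).symm
        _ ≤ _ := Finset.sum_le_sum hd
    obtain ⟨v, hv, hvd⟩ := Finset.exists_le_of_sum_le hne hsum
    obtain ⟨f, f1, f2⟩ := ih (A.erase v)
      (fun u hu => (Finset.card_le_card
        (Finset.filter_subset_filter _ (Finset.erase_subset _ _))).trans
          (hd u (Finset.mem_of_mem_erase hu)))
      (by rw [Finset.card_erase_of_mem hv]; omega)
    let N := A.filter (fun u => E v u) ∪ A.filter (fun u => E u v)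
    have hN : N.card ≤ 2 * d := (Finset.card_union_le _ _).trans (by have := hd v hv; omega)
    have : ∃ c ∈ Finset.range (2 * d + 1), c ∉ N.image f := by
      by_contra hcon
      push Not at hcon
      have h1 := Finset.card_le_card (show Finset.range (2 * d + 1) ⊆ N.image f from hcon)
      have h2 := Finset.card_image_le (s := N) (f := f)
      rw [Finset.card_range] at h1
      omega
    obtain ⟨c, hc, hcN⟩ := this
    have hcN' : ∀ u ∈ A, (E v u ∨ E u v) → f u ≠ c := by
      intro u hu h he
      apply hcN
      rw [Finset.mem_image]
      refine ⟨u, ?_, he⟩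
      simp only [N, Finset.mem_union, Finset.mem_filter]
      tauto
    refine ⟨Function.update f v c, ?_, ?_⟩
    · intro u hu
      by_cases h : u = v
      · subst h; simpa using hc
      · rw [Function.update_of_ne h]
        exact f1 u (by simpa [h] using hu)
    · intro u hu w hw huw
      by_cases h : u = v <;> by_cases h' : w = v
      · subst h; subst h'; exact absurd huw (hl _)
      · subst h; rw [Function.update_self, Function.update_of_ne h']
        exact (hcN' w hw (Or.inl huw)).symm
      · subst h'; rw [Function.update_self, Function.update_of_ne h]
        exact hcN' u hu (Or.inr huw)
      · rw [Function.update_of_ne h, Function.update_of_ne h']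
        exact f2 u (by simpa [h] using hu) w (by simpa [h'] using hw) huw

/-- Given an embedding of `T - v` where the image of the neighbour of the leaf has an unused
neighbour, extend. -/
lemma extend_leaf {V W : Type*} {E : V → V → Prop} {T : W → W → Prop} (v : W)
    (S : Set V) (f : ({v}ᶜ : Set W) → V) (hf : Function.Injective f) (hfS : ∀ w, f w ∈ S)
    (hE : ∀ a b : ({v}ᶜ : Set W), T a b → E (f a) (f b)) (hl : ¬ T v v)
    (x : V) (hxS : x ∈ S) (hx : ∀ w, f w ≠ x)
    (h1 : ∀ a : ({v}ᶜ : Set W), T a v → E (f a) x)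
    (h2 : ∀ a : ({v}ᶜ : Set W), T v a → E x (f a)) :
    ∃ g : W → V, Function.Injective g ∧ (∀ w, g w ∈ S) ∧ ∀ a b, T a b → E (g a) (g b) := by
  classical
  refine ⟨fun w => if h : w = v then x else f ⟨w, h⟩, ?_, ?_, ?_⟩
  · intro a b hab
    by_cases ha : a = v <;> by_cases hb : b = v
    · rw [ha, hb]
    · simp only [ha, hb, dif_pos, dif_neg, not_false_eq_true] at hab
      exact absurd hab.symm (hx _)
    · simp only [ha, hb, dif_pos, dif_neg, not_false_eq_true] at hab
      exact absurd hab (hx _)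
    · simp only [ha, hb, dif_neg, not_false_eq_true] at hab
      exact congrArg Subtype.val (hf hab)
  · intro w
    by_cases h : w = v
    · simpa [h] using hxS
    · simpa [h] using hfS _
  · intro a b hab
    by_cases ha : a = v <;> by_cases hb : b = v
    · subst ha; subst hb; exact absurd hab hl
    · subst ha
      simp only [hb, dif_pos, dif_neg, not_false_eq_true]
      exact h2 ⟨b, hb⟩ hab
    · subst hb
      simp only [ha, dif_pos, dif_neg, not_false_eq_true]
      exact h1 ⟨a, ha⟩ hab
    · simp only [ha, hb, dif_neg, not_false_eq_true]
      exact hE ⟨a, ha⟩ ⟨b, hb⟩ hab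

lemma IsTreeOrientation.exists_leaf {W : Type*} [Finite W] [Nontrivial W] {T : W → W → Prop}
    (hT : IsTreeOrientation T) :
    ∃ v : W, ∃ u : ({v}ᶜ : Set W),
      IsTreeOrientation (fun a b : ({v}ᶜ : Set W) => T a b) ∧
      ∀ a : ({v}ᶜ : Set W), (T a v ∨ T v a) → a = u := by
  classical
  have := Fintype.ofFinite W
  obtain ⟨h1, h2, h3⟩ := hT
  obtain ⟨v, hv⟩ := h3.exists_vert_degree_one_of_nontrivial
  have hconn := h3.connected.induce_compl_singleton_of_degree_eq_one hv
  rw [SimpleGraph.degree_eq_one_iff_existsUnique_adj] at hv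
  obtain ⟨u, hu, huu⟩ := hv
  refine ⟨v, ⟨u, ?_⟩, ⟨fun a => h1 a, fun a b => h2 a b, ?_⟩, ?_⟩
  · intro h
    rw [Set.mem_singleton_iff] at h
    subst h
    exact hu.ne rfl
  · have heq : SimpleGraph.fromRel (fun a b : ({v}ᶜ : Set W) => T a b)
        = (SimpleGraph.fromRel T).induce {v}ᶜ := by
      ext a b
      simp [Subtype.ext_iff]
    rw [heq]
    exact ⟨hconn, h3.isAcyclic.induce _⟩
  · intro a ha
    apply Subtype.ext
    apply huu
    rw [SimpleGraph.fromRel_adj]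
    refine ⟨fun h => a.2 (by simp [h]), by tauto⟩

/-- A weak form of Burr's theorem. -/
lemma burr (j : ℕ) : ∃ c : ℕ, ∀ (V : Type) [Fintype V] (E : V → V → Prop), (∀ v, ¬ E v v) →
    ∀ S : Set V, ¬ ColOn E S c → ∀ (W : Type) [Finite W] (T : W → W → Prop),
    Nat.card W = j + 1 → IsTreeOrientation T →
    ∃ g : W → V, Function.Injective g ∧ (∀ w, g w ∈ S) ∧ ∀ a b, T a b → E (g a) (g b) := by
  classical
  induction j with
  | zero =>
    refine ⟨0, fun V _ E hl S hS W _ T hW hT => ?_⟩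
    have hne : S.Nonempty := by
      by_contra h
      rw [Set.not_nonempty_iff_eq_empty] at h
      subst h
      exact hS ⟨fun _ => 0, by simp, by simp⟩
    obtain ⟨x, hx⟩ := hne
    have hsub : Subsingleton W := (Nat.card_eq_one_iff_unique.mp hW).1
    refine ⟨fun _ => x, fun a b _ => Subsingleton.elim a b, fun _ => hx, fun a b hab => ?_⟩
    rw [Subsingleton.elim a b] at hab
    exact absurd hab (hT.1 b)
  | succ j ih =>
    obtain ⟨c, hc⟩ := ih
    refine ⟨c + (2 * (j + 1) + 1), fun V _ E hl S hS W _ T hW hT => ?_⟩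
    have hnt : Nontrivial W := by
      have := Fintype.ofFinite W
      rw [Nat.card_eq_fintype_card] at hW
      exact Fintype.one_lt_card_iff_nontrivial.mp (by omega)
    obtain ⟨v, u, hT', hu⟩ := hT.exists_leaf
    have hcard : Nat.card ({v}ᶜ : Set W) = j + 1 := by
      have := Fintype.ofFinite W
      rw [Nat.card_eq_fintype_card, Fintype.card_compl_set]
      rw [Nat.card_eq_fintype_card] at hW
      simp [hW]
    -- a relation `F` chosen so that the new vertex `x` must satisfy `F (f u) x`
    have key : ∀ F : V → V → Prop, (∀ a, ¬ F a a) → (∀ a b, E a b ↔ E a b) →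
        (∀ A : Set V, ColOn F A (2 * (j + 1) + 1) → ColOn E A (2 * (j + 1) + 1)) →
        ∃ f : ({v}ᶜ : Set W) → V, Function.Injective f ∧ (∀ w, f w ∈ S) ∧
          (∀ a b : ({v}ᶜ : Set W), T a b → E (f a) (f b)) ∧
          ∃ x ∈ S, (∀ w, f w ≠ x) ∧ F (f u) x := by
      intro F hlF _ hFE
      let A : Finset V := Finset.univ.filter (fun a => a ∈ S ∧
        (Finset.univ.filter (fun b => b ∈ S ∧ F a b)).card ≤ j + 1)
      have hA : ColOn F (A : Set V) (2 * (j + 1) + 1) := by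
        apply colOn_of_outdeg hlF
        intro a ha
        refine le_trans (Finset.card_le_card ?_) (Finset.mem_filter.mp ha).2.2
        intro b hb
        simp only [Finset.mem_filter, A] at hb ⊢
        exact ⟨Finset.mem_univ _, hb.1.2.1, hb.2⟩
      have hS' : ¬ ColOn E (S \ (A : Set V)) c := by
        intro h
        exact hS ((h.union (hFE _ hA)).mono (by intro x hx; by_cases h : x ∈ (A : Set V) <;> simp_all) le_rfl)
      obtain ⟨f, f1, f2, f3⟩ := hc V E hl (S \ A) hS' _ _ hcard hT'
      refine ⟨f, f1, fun w => (f2 w).1, f3, ?_⟩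
      have hbig : j + 1 < (Finset.univ.filter (fun b => b ∈ S ∧ F (f u) b)).card := by
        by_contra hcon
        apply (f2 u).2
        simp only [A, Finset.coe_filter, Set.mem_ofPred_eq]
        exact ⟨Finset.mem_univ _, (f2 u).1, not_lt.mp hcon⟩
      have := Fintype.ofFinite W
      have himg : (Finset.univ.image f).card ≤ j + 1 := by
        refine Finset.card_image_le.trans ?_
        rw [Finset.card_univ, ← Nat.card_eq_fintype_card, hcard]
      obtain ⟨x, hx, hx'⟩ := Finset.exists_mem_notMem_of_card_lt_card (himg.trans_lt hbig)
      rw [Finset.mem_filter] at hx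
      refine ⟨x, hx.2.1, fun w hw => hx' ?_, hx.2.2⟩
      rw [Finset.mem_image]
      exact ⟨w, Finset.mem_univ _, hw⟩
    by_cases huv : T u v
    · obtain ⟨f, f1, f2, f3, x, hxS, hx, hEx⟩ := key E hl (fun _ _ => Iff.rfl) (fun _ h => h)
      refine extend_leaf v S f f1 f2 f3 (hT.1 v) x hxS hx ?_ ?_
      · intro a ha; rw [hu a (Or.inl ha)]; exact hEx
      · intro a ha; rw [hu a (Or.inr ha)] at ha; exact absurd ha (hT.2.1 _ _ huv)
    · obtain ⟨f, f1, f2, f3, x, hxS, hx, hEx⟩ := key (fun a b => E b a) hl (fun _ _ => Iff.rfl)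
        (fun A ⟨g, g1, g2⟩ => ⟨g, g1, fun p hp q hq hpq => (g2 q hq p hp hpq).symm⟩)
      refine extend_leaf v S f f1 f2 f3 (hT.1 v) x hxS hx ?_ ?_
      · intro a ha; rw [hu a (Or.inl ha)] at ha; exact absurd ha huv
      · intro a ha; rw [hu a (Or.inr ha)]; exact hEx

lemma colOn_of_colorable {V : Type*} {E : V → V → Prop} (hl : ∀ v, ¬ E v v) {m : ℕ}
    (h : (SimpleGraph.fromRel E).Colorable m) : ColOn E Set.univ m := by
  obtain ⟨C⟩ := h
  refine ⟨fun v => (C v : ℕ), fun v _ => (C v).2, fun u _ v _ huv he => ?_⟩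
  refine C.valid (v := u) (w := v) ?_ (Fin.ext he)
  rw [SimpleGraph.fromRel_adj]
  exact ⟨fun h => hl u (by simpa [← h] using huv), Or.inl huv⟩

/-- `cstar` does what it should. -/
lemma cstar_spec (j : ℕ) (hj : 1 ≤ j) : 0 < cstar j ∧
    ∀ (n : ℕ) (E : Fin n → Fin n → Prop), (∀ v, ¬ E v v) →
      (cstar j : ℕ∞) ≤ (SimpleGraph.fromRel E).chromaticNumber →
      ∀ T : Fin j → Fin j → Prop, IsTreeOrientation T → ContainsDigraph E T := by
  have hne : {c : ℕ | 0 < c ∧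
    ∀ (n : ℕ) (E : Fin n → Fin n → Prop), (∀ v, ¬ E v v) →
      (c : ℕ∞) ≤ (SimpleGraph.fromRel E).chromaticNumber →
      ∀ T : Fin j → Fin j → Prop, IsTreeOrientation T → ContainsDigraph E T}.Nonempty := by
    obtain ⟨c, hc⟩ := burr (j - 1)
    refine ⟨c + 1, Nat.succ_pos _, fun n E hl hchi T hT => ?_⟩
    have hcol : ¬ ColOn E Set.univ c := by
      intro h
      have h1 := SimpleGraph.chromaticNumber_le_iff_colorable.mpr (colorable_of_colOn h)
      have h2 := hchi.trans h1
      have : c + 1 ≤ c := by exact_mod_cast h2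
      omega
    obtain ⟨g, g1, -, g3⟩ := hc (Fin n) E hl _ hcol (Fin j) T (by simp; omega) hT
    exact ⟨g, g1, g3⟩
  exact Nat.sInf_mem hne

lemma embed_tree {n j : ℕ} (hj : 1 ≤ j) {E : Fin n → Fin n → Prop} (hl : ∀ v, ¬ E v v)
    (S : Set (Fin n)) (hS : ¬ ColOn E S (cstar j - 1)) {T : Fin j → Fin j → Prop}
    (hT : IsTreeOrientation T) :
    ∃ g : Fin j → Fin n, Function.Injective g ∧ (∀ w, g w ∈ S) ∧
      ∀ a b, T a b → E (g a) (g b) := by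
  classical
  obtain ⟨hpos, hc⟩ := cstar_spec j hj
  let e := Fintype.equivFin S
  let E' : Fin (Fintype.card S) → Fin (Fintype.card S) → Prop :=
    fun a b => E (e.symm a) (e.symm b)
  have hl' : ∀ v, ¬ E' v v := fun v => hl _
  have hchi : (cstar j : ℕ∞) ≤ (SimpleGraph.fromRel E').chromaticNumber := by
    by_contra hcon
    rw [not_le] at hcon
    have hle : (SimpleGraph.fromRel E').chromaticNumber ≤ ((cstar j - 1 : ℕ) : ℕ∞) := by
      apply Order.le_of_lt_add_one
      have : ((cstar j - 1 : ℕ) : ℕ∞) + 1 = (cstar j : ℕ∞) := by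
        exact_mod_cast Nat.sub_add_cancel hpos
      rwa [this]
    rw [SimpleGraph.chromaticNumber_le_iff_colorable] at hle
    obtain ⟨f, f1, f2⟩ := colOn_of_colorable hl' hle
    apply hS
    refine ⟨fun v => if h : v ∈ S then f (e ⟨v, h⟩) else 0, ?_, ?_⟩
    · intro v hv
      simp only [hv, dif_pos]
      exact f1 _ trivial
    · intro u hu v hv huv
      simp only [hu, hv, dif_pos]
      exact f2 _ trivial _ trivial (by simpa [E'] using huv)
  obtain ⟨g, g1, g2⟩ := hc _ E' hl' hchi T hT
  exact ⟨fun a => (e.symm (g a) : Fin n), fun a b hab => g1 (e.symm.injective (Subtype.ext hab)),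
    fun w => (e.symm (g w)).2, g2⟩

/-- The oriented path on `Fin j` with orientation `p`. -/
def pathRel (j : ℕ) (p : ℕ → Bool) : Fin j → Fin j → Prop := fun a b =>
  (b.val = a.val + 1 ∧ p a.val = true) ∨ (a.val = b.val + 1 ∧ p b.val = false)

lemma pathRel_tree (j : ℕ) (hj : 1 ≤ j) (p : ℕ → Bool) : IsTreeOrientation (pathRel j p) := by
  obtain ⟨m, rfl⟩ : ∃ m, j = m + 1 := ⟨j - 1, by omega⟩
  refine ⟨?_, ?_, ?_⟩
  · rintro v (h | h) <;> omega
  · rintro u v (h | h) (h' | h')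
    · omega
    · have : v = v := rfl
      rw [h.2] at h'; simp at h'
    · rw [h.2] at h'; simp at h'
    · omega
  · have heq : SimpleGraph.fromRel (pathRel (m + 1) p) = SimpleGraph.pathGraph (m + 1) := by
      ext a b
      rw [SimpleGraph.fromRel_adj, SimpleGraph.pathGraph_adj]
      simp only [pathRel]
      constructor
      · rintro ⟨_, (h | h) | (h | h)⟩ <;> omega
      · intro h
        refine ⟨fun hab => by subst hab; omega, ?_⟩
        rcases h with h | h
        · cases hp : p a.val
          · right; right; exact ⟨h.symm, rfl⟩
          · left; left; exact ⟨h.symm, rfl⟩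
        · cases hp : p b.val
          · left; right; exact ⟨h.symm, rfl⟩
          · right; left; exact ⟨h.symm, rfl⟩
    rw [heq, SimpleGraph.isTree_iff_connected_and_card]
    refine ⟨SimpleGraph.pathGraph_connected m, ?_⟩
    have hr : (SimpleGraph.pathGraph (m + 1)).edgeSet =
        Set.range (fun i : Fin m => s(i.castSucc, i.succ)) := by
      ext e
      induction e using Sym2.ind with
      | _ a b =>
        rw [SimpleGraph.mem_edgeSet, SimpleGraph.pathGraph_adj, Set.mem_range]
        constructor
        · rintro (h | h)
          · refine ⟨⟨a.val, by omega⟩, ?_⟩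
            rw [Sym2.eq_iff]; left
            exact ⟨Fin.ext rfl, Fin.ext h⟩
          · refine ⟨⟨b.val, by omega⟩, ?_⟩
            rw [Sym2.eq_iff]; right
            exact ⟨Fin.ext rfl, Fin.ext h⟩
        · rintro ⟨i, hi⟩
          rw [Sym2.eq_iff] at hi
          rcases hi with ⟨rfl, rfl⟩ | ⟨rfl, rfl⟩ <;> simp
    have hinj : Function.Injective (fun i : Fin m => s(i.castSucc, i.succ)) := by
      intro i i' h
      simp only [Sym2.eq_iff, Fin.ext_iff, Fin.val_castSucc, Fin.val_succ] at h
      apply Fin.ext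
      omega
    rw [hr, Nat.card_range_of_injective hinj]
    simp

lemma exists_pattern (k : ℕ) (o : ZMod k → Bool)
    (hC : (k = 4 ∧ ∀ i : ZMod k, o i = decide (i.val < 2)) ∨
          (5 ≤ k ∧ ContainsDigraph (cycleOrient o) pathFFBB)) :
    ∃ a : ZMod k, o a = true ∧ o (a + 1) = true ∧ o (a + 2) = false ∧ o (a + 3) = false := by
  rcases hC with ⟨rfl, h⟩ | ⟨hk, f, hf, h⟩
  · refine ⟨0, ?_, ?_, ?_, ?_⟩ <;> rw [h] <;> decide
  · have h01 := h 0 1 (by simp [pathFFBB])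
    have h12 := h 1 2 (by simp [pathFFBB])
    have h32 := h 3 2 (by simp [pathFFBB])
    have h43 := h 4 3 (by simp [pathFFBB])
    have n02 : f 0 ≠ f 2 := fun h => absurd (hf h) (by decide)
    have n13 : f 1 ≠ f 3 := fun h => absurd (hf h) (by decide)
    have n24 : f 2 ≠ f 4 := fun h => absurd (hf h) (by decide)
    simp only [cycleOrient] at h01 h12 h32 h43
    rcases h01 with ⟨p1, q1⟩ | ⟨p1, q1⟩
    · have h2 : o (f 1) = true ∧ f 2 = f 1 + 1 := by
        rcases h12 with h | h
        · exact h
        · exact absurd (add_right_cancel (q1.symm.trans h.2)) n02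
      have h3 : o (f 2) = false ∧ f 3 = f 2 + 1 := by
        rcases h32 with h | h
        · exact absurd (add_right_cancel (h2.2.symm.trans h.2)) n13
        · exact h
      have h4 : o (f 3) = false ∧ f 4 = f 3 + 1 := by
        rcases h43 with h | h
        · exact absurd (add_right_cancel (h3.2.symm.trans h.2)) n24
        · exact h
      refine ⟨f 0, p1, ?_, ?_, ?_⟩
      · rw [← q1]; exact h2.1
      · rw [← h3.1, h2.2, q1]; congr 1; ring
      · rw [← h4.1, h3.2, h2.2, q1]; congr 1; ring
    · have h2 : o (f 2) = false ∧ f 1 = f 2 + 1 := by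
        rcases h12 with h | h
        · exact absurd (q1.trans h.2.symm) n02
        · exact h
      have h3 : o (f 3) = true ∧ f 2 = f 3 + 1 := by
        rcases h32 with h | h
        · exact h
        · exact absurd (h2.2.trans h.2.symm) n13
      have h4 : o (f 4) = true ∧ f 3 = f 4 + 1 := by
        rcases h43 with h | h
        · exact h
        · exact absurd (h3.2.trans h.2.symm) n24
      refine ⟨f 4, h4.1, ?_, ?_, ?_⟩
      · rw [← h4.2]; exact h3.1
      · rw [← h2.1, h3.2, h4.2]; congr 1; ring
      · rw [← p1, h2.2, h3.2, h4.2]; congr 1; ring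

/-- closing up the path to a cycle -/
lemma close_cycle {V : Type*} {E : V → V → Prop} {k : ℕ} (hk : 4 ≤ k) (o : ZMod k → Bool)
    (a : ZMod k) (ha1 : o (a + 1) = true) (ha2 : o (a + 2) = false)
    (g : ℕ → V) (w : V)
    (hinj : ∀ i j, i < k - 1 → j < k - 1 → g i = g j → i = j)
    (hw : ∀ i, i < k - 1 → g i ≠ w)
    (hf : ∀ i : ℕ, i + 1 < k - 1 → o (a + 3 + (i : ZMod k)) = true → E (g i) (g (i + 1)))
    (hb : ∀ i : ℕ, i + 1 < k - 1 → o (a + 3 + (i : ZMod k)) = false → E (g (i + 1)) (g i))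
    (h0 : E (g 0) w) (h1 : E (g (k - 2)) w) : ContainsDigraph E (cycleOrient o) := by
  have : NeZero k := ⟨by omega⟩
  have : Fact (1 < k) := ⟨by omega⟩
  let h : ℕ → V := fun m => if m < k - 1 then g m else w
  have hstep : ∀ z : ZMod k, (o z = true → E (h (z - (a + 3)).val) (h (z + 1 - (a + 3)).val)) ∧
      (o z = false → E (h (z + 1 - (a + 3)).val) (h (z - (a + 3)).val)) := by
    intro z
    obtain ⟨y, rfl⟩ : ∃ y, z = a + 3 + y := ⟨z - (a + 3), by ring⟩
    rw [show a + 3 + y - (a + 3) = y by ring, show a + 3 + y + 1 - (a + 3) = y + 1 by ring]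
    have hyc : ((y.val : ℕ) : ZMod k) = y := ZMod.natCast_zmod_val y
    have hy := ZMod.val_lt y
    have hkk : ((k : ℕ) : ZMod k) = 0 := ZMod.natCast_self k
    by_cases hlast : y.val + 1 = k
    · have hy1 : y + 1 = 0 := by
        rw [← hyc, ← Nat.cast_one, ← Nat.cast_add, hlast, hkk]
      have ho : o (a + 3 + y) = false := by
        rw [← ha2]; congr 1
        rw [show y = -1 from eq_neg_of_add_eq_zero_left hy1]; ring
      rw [hy1, ZMod.val_zero]
      have e1 : h 0 = g 0 := if_pos (by omega)
      have e2 : h y.val = w := if_neg (by omega)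
      rw [e1, e2, ho]
      simpa using h0
    · have hv : (y + 1).val = y.val + 1 := by
        rw [ZMod.val_add, ZMod.val_one, Nat.mod_eq_of_lt (by omega)]
      rw [hv]
      by_cases h2 : y.val + 1 = k - 1
      · have hy1 : y + 2 = 0 := by
          rw [← hyc, ← Nat.cast_two, ← Nat.cast_add, show y.val + 2 = k by omega, hkk]
        have ho : o (a + 3 + y) = true := by
          rw [← ha1]; congr 1
          rw [show y = -2 from eq_neg_of_add_eq_zero_left hy1]; ring
        have e1 : h (y.val + 1) = w := if_neg (by omega)
        have e2 : h y.val = g (k - 2) := by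
          rw [show y.val = k - 2 by omega]; exact if_pos (by omega)
        rw [e1, e2, ho]
        simpa using h1
      · have e1 : h (y.val + 1) = g (y.val + 1) := if_pos (by omega)
        have e2 : h y.val = g y.val := if_pos (by omega)
        rw [e1, e2]
        have hf' := hf y.val (by omega)
        have hb' := hb y.val (by omega)
        rw [hyc] at hf' hb'
        exact ⟨hf', hb'⟩
  refine ⟨fun z => h (z - (a + 3)).val, ?_, ?_⟩
  · intro z z' hzz
    have hz := ZMod.val_lt (z - (a + 3))
    have hz' := ZMod.val_lt (z' - (a + 3))
    have : (z - (a + 3)).val = (z' - (a + 3)).val := by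
      simp only [h] at hzz
      split_ifs at hzz with c1 c2 c2
      · exact hinj _ _ c1 c2 hzz
      · exact absurd hzz (hw _ c1)
      · exact absurd hzz.symm (hw _ c2)
      · omega
    exact sub_left_injective (ZMod.val_injective k this)
  · rintro u v (⟨h, rfl⟩ | ⟨h, rfl⟩)
    · exact (hstep u).1 h
    · exact (hstep v).2 h

/-- A small set of vertices hit by almost all vertices. -/
lemma exists_hitting {n : ℕ} {E : Fin n → Fin n → Prop} [DecidableRel E] {ε : ℝ} (hε : 0 < ε)
    (hn : 0 < n)
    (hdeg : ∀ v : Fin n, ε * (n : ℝ) ≤ ((Finset.univ.filter (fun u => E v u)).card : ℝ)) :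
    ∃ S : Finset (Fin n), (S.card : ℝ) * ε ^ 2 ≤ 2 ∧
      (((Finset.univ.filter (fun u => ∀ w ∈ S, ¬ E u w)).card : ℕ) : ℝ) ≤ ε * n / 2 := by
  classical
  let M : Finset (Fin n) → Finset (Fin n) := fun S => Finset.univ.filter (fun u => ∀ w ∈ S, ¬ E u w)
  obtain ⟨S, -, hS⟩ := Finset.exists_min_image (Finset.univ : Finset (Finset (Fin n)))
    (fun S => ((M S).card : ℝ) + ε ^ 2 * n / 2 * S.card) ⟨∅, Finset.mem_univ _⟩
  have hn' : (0 : ℝ) < n := by exact_mod_cast hn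
  refine ⟨S, ?_, ?_⟩
  · have h0 := hS ∅ (Finset.mem_univ _)
    have h1 : ((M ∅).card : ℝ) ≤ n := by
      have := Finset.card_le_univ (M ∅)
      rw [Fintype.card_fin] at this
      exact_mod_cast this
    simp only [Finset.card_empty, Nat.cast_zero, mul_zero, add_zero] at h0
    have h2 : (0 : ℝ) ≤ (M S).card := Nat.cast_nonneg _
    have h3 : n * ((S.card : ℝ) * ε ^ 2) ≤ n * 2 := by nlinarith
    exact le_of_mul_le_mul_left h3 hn'
  · by_contra hcon
    rw [not_le] at hcon
    change ε * n / 2 < ((M S).card : ℝ) at hcon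
    -- double counting
    have hdc : ∑ v ∈ M S, ((Finset.univ.filter (fun u => E v u)).card) =
        ∑ w : Fin n, ((M S).filter (fun u => E u w)).card :=
      Finset.sum_card_bipartiteAbove_eq_sum_card_bipartiteBelow (s := M S) (t := Finset.univ) E
    have hlow : ((M S).card : ℝ) * (ε * n) ≤ ∑ w : Fin n, (((M S).filter (fun u => E u w)).card : ℝ) := by
      have : (∑ v ∈ M S, ((Finset.univ.filter (fun u => E v u)).card : ℝ)) =
        ∑ w : Fin n, (((M S).filter (fun u => E u w)).card : ℝ) := by exact_mod_cast hdc
      rw [← this, ← nsmul_eq_mul]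
      exact Finset.card_nsmul_le_sum _ _ _ (fun v _ => hdeg v)
    have hex : ∃ w ∈ (Finset.univ : Finset (Fin n)),
        ε * (M S).card ≤ (((M S).filter (fun u => E u w)).card : ℝ) := by
      apply Finset.exists_le_of_sum_le ⟨⟨0, hn⟩, Finset.mem_univ _⟩
      rw [Finset.sum_const, Finset.card_univ, Fintype.card_fin, nsmul_eq_mul]
      linarith
    obtain ⟨w, -, hw⟩ := hex
    have h1 := hS (insert w S) (Finset.mem_univ _)
    have hM : M (insert w S) = (M S).filter (fun u => ¬ E u w) := by
      ext u
      simp only [M, Finset.mem_filter, Finset.mem_univ, true_and, Finset.mem_insert, forall_eq_or_imp]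
      tauto
    have hcard := Finset.card_filter_add_card_filter_not (s := M S) (fun u => E u w)
    rw [← hM] at hcard
    have hcard' : (((M S).filter (fun u => E u w)).card : ℝ) + ((M (insert w S)).card : ℝ)
      = ((M S).card : ℝ) := by exact_mod_cast hcard
    have hins : ((insert w S).card : ℝ) ≤ S.card + 1 := by
      exact_mod_cast Finset.card_insert_le w S
    have hpos : 0 ≤ ε ^ 2 * n / 2 := by positivity
    have h2 := mul_le_mul_of_nonneg_left hins hpos
    have h3 : ε * (ε * n / 2) < ε * (M S).card := mul_lt_mul_of_pos_left hcon hε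
    nlinarith

/-- Lemma 2.2. Let `C` be an orientation of the `k`-cycle (`k ≥ 4`) which, if `k ≥ 5`,
contains `→ → ← ←` as a subdigraph, and, if `k = 4`, is the orientation of the 4-cycle
obtained by identifying the endpoints of `→ → ← ←` (edges `0, 1` forward and `2, 3`
backward). Every digraph without loops or parallel arcs with `|V(D)| ≥ 48/ε³`,
`χ(D) ≥ 16·c*_{k-1}/ε²`, and minimum out-degree at least `ε·|V(D)|` contains `C`. -/
theorem contains_cycle_with_ffbb
    (ε : ℝ) (hε : 0 < ε) (k : ℕ) (hk : 4 ≤ k) (o : ZMod k → Bool)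
    (hC : (k = 4 ∧ ∀ i : ZMod k, o i = decide (i.val < 2)) ∨
          (5 ≤ k ∧ ContainsDigraph (cycleOrient o) pathFFBB))
    (n : ℕ) (E : Fin n → Fin n → Prop) (hloops : ∀ v, ¬ E v v)
    (hn : 48 / ε ^ 3 ≤ (n : ℝ))
    (hchrom : 16 * (cstar (k - 1) : ℝ) / ε ^ 2 ≤ (dchrom E : ℝ))
    (hdeg : ∀ v : Fin n, ε * (n : ℝ) ≤ (Nat.card {u : Fin n // E v u} : ℝ)) :
    ContainsDigraph E (cycleOrient o) := by
  classical
  obtain ⟨a, ha0, ha1, ha2, ha3⟩ := exists_pattern k o hC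
  have hn' : (0 : ℝ) < n := lt_of_lt_of_le (by positivity) hn
  have hn0 : 0 < n := by exact_mod_cast hn'
  have hdeg' : ∀ v : Fin n, ε * (n : ℝ) ≤ ((Finset.univ.filter (fun u => E v u)).card : ℝ) := by
    intro v
    have := hdeg v
    rwa [Nat.card_eq_fintype_card, Fintype.card_subtype] at this
  obtain ⟨S, hS, hM⟩ := exists_hitting hε hn0 hdeg'
  have hε3 : 48 ≤ n * ε ^ 3 := (div_le_iff₀ (by positivity)).mp hn
  set M := Finset.univ.filter (fun u => ∀ w ∈ S, ¬ E u w) with hMdef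
  set c := cstar (k - 1) with hc
  have hcpos : 0 < c := (cstar_spec (k - 1) (by omega)).1
  let p : ℕ → Bool := fun i => o (a + 3 + (i : ZMod k))
  have hT := pathRel_tree (k - 1) (by omega) p
  have hkk : ((k : ℕ) : ZMod k) = 0 := ZMod.natCast_self k
  -- pass from `Fin (k-1)` to `ℕ`
  have hpass : ∀ X : Set (Fin n), ¬ ColOn E X (c - 1) → ∃ g : ℕ → Fin n,
      (∀ i j, i < k - 1 → j < k - 1 → g i = g j → i = j) ∧ (∀ i, i < k - 1 → g i ∈ X) ∧
      (∀ i : ℕ, i + 1 < k - 1 → o (a + 3 + (i : ZMod k)) = true → E (g i) (g (i + 1))) ∧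
      (∀ i : ℕ, i + 1 < k - 1 → o (a + 3 + (i : ZMod k)) = false → E (g (i + 1)) (g i)) := by
    intro X hX
    obtain ⟨g, g1, g2, g3⟩ := embed_tree (by omega) hloops X hX hT
    refine ⟨fun i => if h : i < k - 1 then g ⟨i, h⟩ else ⟨0, hn0⟩, ?_, ?_, ?_, ?_⟩
    · intro i j hi hj hij
      simp only [hi, hj, dif_pos] at hij
      exact congrArg Fin.val (g1 hij)
    · intro i hi
      simp only [hi, dif_pos]
      exact g2 _
    · intro i hi ho
      have hi' : i < k - 1 := by omega
      simp only [hi, hi', dif_pos]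
      exact g3 _ _ (Or.inl ⟨rfl, ho⟩)
    · intro i hi ho
      have hi' : i < k - 1 := by omega
      simp only [hi, hi', dif_pos]
      exact g3 _ _ (Or.inr ⟨rfl, ho⟩)
  by_contra hno
  -- in-neighbourhoods of vertices have small chromatic number
  have hin : ∀ w ∈ S, ColOn E {u | E u w} (c - 1) := by
    intro w _
    by_contra hcol
    obtain ⟨g, g1, g2, g3, g4⟩ := hpass _ hcol
    exact hno (close_cycle hk o a ha1 ha2 g w g1
      (fun i hi h => hloops w (by have := g2 i hi; rwa [h] at this)) g3 g4
      (g2 0 (by omega)) (g2 (k - 2) (by omega)))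
  let R : Fin n → Set (Fin n) := fun w =>
    {v | v ∈ M ∧ 2 ≤ (Finset.univ.filter (fun u => E v u ∧ E u w)).card}
  have hR : ∀ w ∈ S, ColOn E (R w \ {w}) (c - 1) := by
    intro w hwS
    by_contra hcol
    obtain ⟨g, g1, g2, g3, g4⟩ := hpass _ hcol
    have hgM : ∀ i, i < k - 1 → ∀ x, E x w → g i ≠ x := by
      intro i hi x hx he
      have := (Finset.mem_filter.mp (g2 i hi).1.1).2 w hwS
      rw [he] at this
      exact this hx
    obtain ⟨x, hx⟩ : ∃ x, x ∈ Finset.univ.filter (fun u => E (g 1) u ∧ E u w) := by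
      apply Finset.card_pos.mp
      have := (g2 1 (by omega)).1.2
      omega
    obtain ⟨y, hy, hyx⟩ : ∃ y ∈ Finset.univ.filter (fun u => E (g (k - 3)) u ∧ E u w), y ≠ x :=
      Finset.exists_mem_ne (by have := (g2 (k - 3) (by omega)).1.2; omega) x
    simp only [Finset.mem_filter, Finset.mem_univ, true_and] at hx hy
    let g' : ℕ → Fin n := fun i => if i = 0 then x else if i = k - 2 then y else g i
    have e0 : g' 0 = x := by simp [g']
    have e1 : g' (k - 2) = y := by
      have : k - 2 ≠ 0 := by omega
      simp [g', this]
    have e2 : ∀ i, i ≠ 0 → i ≠ k - 2 → g' i = g i := by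
      intro i h h'
      simp [g', h, h']
    refine hno (close_cycle hk o a ha1 ha2 g' w ?_ ?_ ?_ ?_ ?_ ?_)
    · intro i j hi hj hij
      have hxi := hgM i hi x hx.2
      have hyi := hgM i hi y hy.2
      have hxj := hgM j hj x hx.2
      have hyj := hgM j hj y hy.2
      simp only [g'] at hij
      split_ifs at hij
      all_goals first
        | omega
        | exact g1 i j hi hj hij
        | exact absurd hij hxi
        | exact absurd hij hyi
        | exact absurd hij.symm hxj
        | exact absurd hij.symm hyj
        | exact absurd hij hyx
        | exact absurd hij.symm hyx
    · intro i hi h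
      have hx' : x ≠ w := fun h => hloops w (by simpa [h] using hx.2)
      have hy' : y ≠ w := fun h => hloops w (by simpa [h] using hy.2)
      simp only [g'] at h
      split_ifs at h
      · exact hx' h
      · exact hy' h
      · exact (g2 i hi).2 h
    · intro i hi ho
      by_cases hi0 : i = 0
      · subst hi0
        rw [Nat.cast_zero, add_zero, ha3] at ho
        simp at ho
      · by_cases hi1 : i + 1 = k - 2
        · rw [hi1, e1, e2 i hi0 (by omega), show i = k - 3 by omega]
          exact hy.1
        · rw [e2 i hi0 (by omega), e2 (i + 1) (by omega) hi1]
          exact g3 i hi ho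
    · intro i hi ho
      by_cases hi0 : i = 0
      · subst hi0
        rw [e0, e2 (0 + 1) (by omega) (by omega)]
        exact hx.1
      · by_cases hi1 : i + 1 = k - 2
        · have : (a + 3 + (i : ZMod k)) = a := by
            have h3 : ((i + 3 : ℕ) : ZMod k) = 0 := by rw [show i + 3 = k by omega, hkk]
            push_cast at h3
            linear_combination h3
          rw [this, ha0] at ho
          simp at ho
        · rw [e2 i hi0 (by omega), e2 (i + 1) (by omega) hi1]
          exact g4 i hi ho
    · rw [e0]; exact hx.2
    · rw [e1]; exact hy.2
  -- every vertex of `M` is in some `R w`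
  have hcover : ∀ v ∈ M, ∃ w ∈ S, v ∈ R w := by
    intro v hv
    by_contra hcon
    push Not at hcon
    have hsmall : ∀ w ∈ S, (Finset.univ.filter (fun u => E v u ∧ E u w)).card ≤ 1 := by
      intro w hw
      by_contra h
      exact hcon w hw ⟨hv, by omega⟩
    have hsub : Finset.univ.filter (fun u => E v u) ⊆
        M ∪ S.biUnion (fun w => Finset.univ.filter (fun u => E v u ∧ E u w)) := by
      intro u hu
      by_cases huM : u ∈ M
      · exact Finset.mem_union_left _ huM
      · apply Finset.mem_union_right
        simp only [hMdef, Finset.mem_filter, Finset.mem_univ, true_and] at huM hu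
        push Not at huM
        obtain ⟨w, hw, huw⟩ := huM
        rw [Finset.mem_biUnion]
        exact ⟨w, hw, by simp [hu, huw]⟩
    have hcard : (Finset.univ.filter (fun u => E v u)).card ≤ M.card + S.card := by
      refine (Finset.card_le_card hsub).trans ((Finset.card_union_le _ _).trans ?_)
      have := Finset.card_biUnion_le_card_mul S _ 1 hsmall
      omega
    have hcard' : ((Finset.univ.filter (fun u => E v u)).card : ℝ) ≤ M.card + S.card := by
      exact_mod_cast hcard
    have h1 := hdeg' v
    have h2 : ε * n / 2 ≤ S.card := by linarith
    have h3 := mul_le_mul_of_nonneg_right h2 (by positivity : 0 ≤ ε ^ 2)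
    nlinarith
  have hR' : ∀ w ∈ S, ColOn E (R w) c := by
    intro w hw
    refine ((hR w hw).union (ColOn.singleton hloops w)).mono ?_ (by omega)
    intro x hx
    by_cases h : x = w
    · exact Or.inr h
    · exact Or.inl ⟨hx, h⟩
  have hall : ColOn E Set.univ (S.card * (c - 1) + S.card * c) := by
    refine ((ColOn.biUnion S _ hin).union (ColOn.biUnion S _ hR')).mono ?_ le_rfl
    intro u _
    by_cases huM : u ∈ M
    · right
      obtain ⟨w, hw, h⟩ := hcover u huM
      exact Set.mem_biUnion hw h
    · left
      simp only [hMdef, Finset.mem_filter, Finset.mem_univ, true_and] at huM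
      push Not at huM
      obtain ⟨w, hw, h⟩ := huM
      exact Set.mem_biUnion hw h
  have hchi := SimpleGraph.chromaticNumber_le_iff_colorable.mpr (colorable_of_colOn hall)
  have hd : dchrom E ≤ S.card * (c - 1) + S.card * c := ENat.toNat_le_of_le_natCast hchi
  have hd2 : dchrom E ≤ 2 * (S.card * c) := by
    have : S.card * (c - 1) ≤ S.card * c := Nat.mul_le_mul_left _ (by omega)
    omega
  have hd3 : (dchrom E : ℝ) ≤ 2 * (S.card * c) := by exact_mod_cast hd2
  have hcR : (0 : ℝ) < c := by exact_mod_cast hcpos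
  have h4 := (div_le_iff₀ (by positivity)).mp (hchrom.trans hd3)
  have h5 := mul_le_mul_of_nonneg_right hS hcR.le
  nlinarith
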